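/- Let Ω be a finite set, β ∈ [0,1], and F ⊆ Ω. Define the contour-enhancement matrix K^{+,β}_F and the contour-reduction matrix K^{−,β}_F, indexed by Finset Ω, by K^{+,β}_F(A, B) = ∏_{ω ∈ F} E^β(χ_A(ω), χ_B(ω)) · ∏_{ω ∉ F} [χ_A(ω) = χ_B(ω)] and K^{−,β}_F(A, B) = ∏_{ω ∈ F} R^β(χ_A(ω), χ_B(ω)) · ∏_{ω ∉ F} [χ_A(ω) = χ_B(ω)], where E^β has entries E(0,0) = 1−β, E(0,1) = 0, E(1,0) = β, E(1,1) = 1 and R^β has entries R(0,0) = 1, R(0,1) = β, R(1,0) = 0, R(1,1) = 1−β. Then for every mass function m on Ω, both K^{+,β}_F ·ᵥ m and K^{−,β}_F ·ᵥ m are mass functions. -/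

import Mathlib

open Finset

/-- Indicator of membership of `ω` in `S`, valued in `{0, 1}`. -/
def chi {Ω : Type*} [DecidableEq Ω] (S : Finset Ω) (ω : Ω) : Fin 2 :=
  if ω ∈ S then 1 else 0

/-- The contour enhancement revision matrix `K^{+,β}_F`, built from
`E^β = [[1−β, 0], [β, 1]]`. -/
def Kcer {Ω : Type*} [Fintype Ω] [DecidableEq Ω] (β : ℝ) (F : Finset Ω) :
    Matrix (Finset Ω) (Finset Ω) ℝ :=
  Matrix.of fun A B =>
    (∏ ω ∈ F, (!![1 - β, 0; β, 1] : Matrix (Fin 2) (Fin 2) ℝ) (chi A ω) (chi B ω)) *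
      ∏ ω ∈ Fᶜ, (if chi A ω = chi B ω then (1 : ℝ) else 0)

/-- The contour reduction revision matrix `K^{−,β}_F`, built from
`R^β = [[1, β], [0, 1−β]]`. -/
def Kcrr {Ω : Type*} [Fintype Ω] [DecidableEq Ω] (β : ℝ) (F : Finset Ω) :
    Matrix (Finset Ω) (Finset Ω) ℝ :=
  Matrix.of fun A B =>
    (∏ ω ∈ F, (!![1, β; 0, 1 - β] : Matrix (Fin 2) (Fin 2) ℝ) (chi A ω) (chi B ω)) *
      ∏ ω ∈ Fᶜ, (if chi A ω = chi B ω then (1 : ℝ) else 0)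

/-- The product over `Ω` of the sums `f ω 0 + f ω 1` expands as a sum over subsets of `Ω`. -/
theorem sum_prod_chi {Ω R : Type*} [Fintype Ω] [DecidableEq Ω] [CommSemiring R]
    (f : Ω → Fin 2 → R) :
    ∑ S : Finset Ω, ∏ ω, f ω (chi S ω) = ∏ ω, ∑ i, f ω i := by
  simp only [Fin.sum_univ_two, add_comm (f _ 0), Fintype.prod_add]
  refine sum_congr rfl fun S _ => ?_
  rw [← prod_mul_prod_compl S]
  congr 1 <;> refine prod_congr rfl fun ω hω => ?_
  · simp [chi, hω]
  · simp [chi, mem_compl.mp hω]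

/-- The Kronecker product over `Ω` of column-stochastic `2 × 2` matrices, with rows and columns
indexed by subsets of `Ω`, is column stochastic. -/
theorem of_prod_chi_mem_colStochastic {Ω R : Type*} [Fintype Ω] [DecidableEq Ω]
    [CommSemiring R] [PartialOrder R] [IsOrderedRing R] {N : Ω → Matrix (Fin 2) (Fin 2) R}
    (hN : ∀ ω, N ω ∈ Matrix.colStochastic R (Fin 2)) :
    Matrix.of (fun A B : Finset Ω => ∏ ω, N ω (chi A ω) (chi B ω)) ∈
      Matrix.colStochastic R (Finset Ω) := by
  refine Matrix.mem_colStochastic_iff_sum.mpr ⟨fun A B => ?_, fun B => ?_⟩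
  · exact prod_nonneg fun ω _ => Matrix.nonneg_of_mem_colStochastic (hN ω)
  · simp only [Matrix.of_apply]
    rw [sum_prod_chi fun ω i => N ω i (chi B ω)]
    exact prod_eq_one fun ω _ => Matrix.sum_col_of_mem_colStochastic (hN ω) _

/-- The revision matrix acting by a column-stochastic matrix `M` at the points of `F`, and by the
identity elsewhere, is column stochastic. -/
theorem revision_mem_colStochastic {Ω R : Type*} [Fintype Ω] [DecidableEq Ω]
    [CommSemiring R] [PartialOrder R] [IsOrderedRing R] {M : Matrix (Fin 2) (Fin 2) R}
    (hM : M ∈ Matrix.colStochastic R (Fin 2)) (F : Finset Ω) :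
    Matrix.of (fun A B : Finset Ω => (∏ ω ∈ F, M (chi A ω) (chi B ω)) *
        ∏ ω ∈ Fᶜ, (if chi A ω = chi B ω then (1 : R) else 0)) ∈
      Matrix.colStochastic R (Finset Ω) := by
  convert of_prod_chi_mem_colStochastic (N := fun ω : Ω => if ω ∈ F then M else 1)
    (fun ω => ?_) using 4 with A B
  · rw [← prod_mul_prod_compl F]
    congr 1 <;> refine prod_congr rfl fun ω hω => ?_
    · simp [hω]
    · simp [mem_compl.mp hω, Matrix.one_apply]
  · split_ifs
    exacts [hM, one_mem _]

theorem Kcer_mem_colStochastic {Ω : Type*} [Fintype Ω] [DecidableEq Ω] {β : ℝ}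
    (h0 : 0 ≤ β) (h1 : β ≤ 1) (F : Finset Ω) :
    Kcer β F ∈ Matrix.colStochastic ℝ (Finset Ω) := by
  refine revision_mem_colStochastic (Matrix.mem_colStochastic_iff_sum.mpr ⟨?_, ?_⟩) F <;>
    simp [Fin.forall_fin_two, h0, h1]

theorem Kcrr_mem_colStochastic {Ω : Type*} [Fintype Ω] [DecidableEq Ω] {β : ℝ}
    (h0 : 0 ≤ β) (h1 : β ≤ 1) (F : Finset Ω) :
    Kcrr β F ∈ Matrix.colStochastic ℝ (Finset Ω) := by
  refine revision_mem_colStochastic (Matrix.mem_colStochastic_iff_sum.mpr ⟨?_, ?_⟩) F <;>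
    simp [Fin.forall_fin_two, h0, h1]

/-- For `β ∈ [0,1]` and any mass function `m`, both the contour enhancement revision
`K^{+,β}_F ·ᵥ m` and the contour reduction revision `K^{−,β}_F ·ᵥ m` are mass functions. -/
theorem cer_crr_preserve_massFunction {Ω : Type*} [Fintype Ω] [DecidableEq Ω]
    (β : ℝ) (hβ : 0 ≤ β ∧ β ≤ 1) (F : Finset Ω)
    (m : Finset Ω → ℝ) (hm : ∀ G, 0 ≤ m G) (hm1 : ∑ G : Finset Ω, m G = 1) :
    ((∀ H : Finset Ω, 0 ≤ (Kcer β F).mulVec m H) ∧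
        ∑ H : Finset Ω, (Kcer β F).mulVec m H = 1) ∧
      (∀ H : Finset Ω, 0 ≤ (Kcrr β F).mulVec m H) ∧
        ∑ H : Finset Ω, (Kcrr β F).mulVec m H = 1 := by
  have hE := Kcer_mem_colStochastic hβ.1 hβ.2 F
  have hR := Kcrr_mem_colStochastic hβ.1 hβ.2 F
  exact ⟨⟨Matrix.nonneg_mulVec_of_mem_colStochastic hE hm,
      (Matrix.sum_mulVec_of_mem_colStochastic hE).trans hm1⟩,
    Matrix.nonneg_mulVec_of_mem_colStochastic hR hm,
    (Matrix.sum_mulVec_of_mem_colStochastic hR).trans hm1⟩
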